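/- arXiv:math/0210189 — 5 statements merged into one kernel-verified Lean document; each statement's English description precedes it below -/
import Mathlib

section
/- Let (X,d) be a metric space and f:[a,b]→X an injective Lipschitz curve with image A = f([a,b]). Then the one-dimensional Hausdorff measure of the path equals the variation of the curve: H¹(A) = Var(f). -/
open MeasureTheory

/-- A preconnected set has one-dimensional Hausdorff measure at least the distance between any two
of its points. -/
theorem IsPreconnected.edist_le_hausdorffMeasure {X : Type*} [MetricSpace X] [MeasurableSpace X]
    [BorelSpace X] {s : Set X} (hs : IsPreconnected s) {x y : X} (hx : x ∈ s) (hy : y ∈ s) :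
    edist x y ≤ μH[1] s := by
  have hIcc : Set.Icc 0 (dist y x) ⊆ (dist · x) '' s := by
    have h := hs.intermediate_value hx hy (f := (dist · x)) (by fun_prop)
    simpa only [dist_self] using h
  calc edist x y = volume (Set.Icc 0 (dist y x)) := by
        rw [Real.volume_Icc, sub_zero, edist_comm, edist_dist]
    _ ≤ μH[1] ((dist · x) '' s) := by
        rw [← hausdorffMeasure_real]
        exact measure_mono hIcc
    _ ≤ μH[1] s := by
        simpa using (LipschitzWith.dist_left x).hausdorffMeasure_image_le zero_le_one s

/-- The variation of an injective continuous curve is at most the one-dimensional Hausdorff measure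
of its image. -/
theorem eVariationOn_le_hausdorffMeasure_image {X : Type*} [MetricSpace X] [MeasurableSpace X]
    [BorelSpace X] {a b : ℝ} {f : ℝ → X} (hf : ContinuousOn f (Set.Icc a b))
    (hinj : Set.InjOn f (Set.Icc a b)) :
    eVariationOn f (Set.Icc a b) ≤ μH[1] (f '' Set.Icc a b) := by
  have := Measure.nullSingletonClass_hausdorff X one_pos
  refine iSup_le fun ⟨n, u, hu, hmem⟩ => ?_
  have hsub (i : ℕ) : Set.Icc (u i) (u (i + 1)) ⊆ Set.Icc a b :=
    Set.Icc_subset_Icc (hmem i).1 (hmem (i + 1)).2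
  have hle (i : ℕ) : u i ≤ u (i + 1) := hu i.le_succ
  have himage (i : ℕ) :
      f '' Set.Ioc (u i) (u (i + 1)) = f '' Set.Icc (u i) (u (i + 1)) \ {f (u i)} := by
    rw [← Set.Icc_sdiff_left, (hinj.mono (hsub i)).image_sdiff_subset
      (Set.singleton_subset_iff.2 (Set.left_mem_Icc.2 (hle i))), Set.image_singleton]
  have hmeas (i : ℕ) : MeasurableSet (f '' Set.Ioc (u i) (u (i + 1))) := by
    rw [himage]
    exact (isCompact_Icc.image_of_continuousOn (hf.mono (hsub i))).measurableSet.diff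
      (measurableSet_singleton _)
  have hdisj : Pairwise (Function.onFun Disjoint fun i => f '' Set.Ioc (u i) (u (i + 1))) :=
    fun i j hij =>
    (hu.pairwise_disjoint_on_Ioc_succ hij).image hinj (Set.Ioc_subset_Icc_self.trans (hsub i))
      (Set.Ioc_subset_Icc_self.trans (hsub j))
  calc ∑ i ∈ Finset.range n, edist (f (u (i + 1))) (f (u i))
      ≤ ∑ i ∈ Finset.range n, μH[1] (f '' Set.Ioc (u i) (u (i + 1))) := by
        refine Finset.sum_le_sum fun i _ => ?_
        rw [himage, measure_sdiff_null (measure_singleton _)]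
        exact (isPreconnected_Icc.image f (hf.mono (hsub i))).edist_le_hausdorffMeasure
          (Set.mem_image_of_mem f (Set.right_mem_Icc.2 (hle i)))
          (Set.mem_image_of_mem f (Set.left_mem_Icc.2 (hle i)))
    _ = μH[1] (⋃ i ∈ Finset.range n, f '' Set.Ioc (u i) (u (i + 1))) :=
        (measure_biUnion_finset (hdisj.set_pairwise _) fun i _ => hmeas i).symm
    _ ≤ μH[1] (f '' Set.Icc a b) := measure_mono <| Set.iUnion₂_subset fun i _ =>
        Set.image_mono (Set.Ioc_subset_Icc_self.trans (hsub i))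

/-- The one-dimensional Hausdorff measure of the image of a Lipschitz curve is at most its
variation. -/
theorem LipschitzOnWith.hausdorffMeasure_image_le_eVariationOn {X : Type*} [MetricSpace X]
    [MeasurableSpace X] [BorelSpace X] {a b : ℝ} (hab : a ≤ b) {f : ℝ → X} {K : NNReal}
    (hf : LipschitzOnWith K f (Set.Icc a b)) :
    μH[1] (f '' Set.Icc a b) ≤ eVariationOn f (Set.Icc a b) := by
  let u (n i : ℕ) : ℝ := a + i * ((b - a) / (n + 1))
  have hstep (n : ℕ) : 0 ≤ (b - a) / (n + 1) := div_nonneg (sub_nonneg.2 hab) (by positivity)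
  have hu (n : ℕ) : Monotone (u n) := fun i j hij => by
    have := hstep n
    dsimp only [u]
    gcongr
  have hu0 (n : ℕ) : u n 0 = a := by simp [u]
  have hun (n : ℕ) : u n (n + 1) = b := by
    simp only [u, Nat.cast_add, Nat.cast_one]
    field_simp
    ring
  let t (n : ℕ) (i : Fin (n + 1)) : Set X := f '' Set.Icc (u n i) (u n (i + 1))
  have hsub (n : ℕ) (i : Fin (n + 1)) : Set.Icc (u n i) (u n (i + 1)) ⊆ Set.Icc a b :=
    Set.Icc_subset_Icc (hu0 n ▸ hu n (Nat.zero_le _)) (hun n ▸ hu n (by lia))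
  have hdiam (n : ℕ) (i : Fin (n + 1)) :
      Metric.ediam (t n i) ≤ K * ENNReal.ofReal ((b - a) / (n + 1)) := by
    refine Metric.ediam_image_le_iff.2 fun x hx y hy => ?_
    refine (hf (hsub n i hx) (hsub n i hy)).trans ?_
    gcongr
    rw [edist_dist]
    refine ENNReal.ofReal_le_ofReal ((Real.dist_le_of_mem_Icc hx hy).trans_eq ?_)
    simp only [u, Nat.cast_add, Nat.cast_one]
    ring
  have hlim : Filter.Tendsto (fun n : ℕ => K * ENNReal.ofReal ((b - a) / (n + 1)))
      Filter.atTop (nhds 0) := by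
    have h : Filter.Tendsto (fun n : ℕ => (b - a) / ((n : ℝ) + 1)) Filter.atTop (nhds 0) :=
      tendsto_const_nhds.div_atTop
        (Filter.tendsto_atTop_add_const_right _ _ tendsto_natCast_atTop_atTop)
    simpa using ENNReal.Tendsto.const_mul (ENNReal.tendsto_ofReal h) (.inr ENNReal.coe_ne_top)
  have hcover (n : ℕ) : f '' Set.Icc a b ⊆ ⋃ i, t n i := by
    rintro _ ⟨x, hx, rfl⟩
    obtain rfl | hax := hx.1.eq_or_lt
    · exact Set.mem_iUnion.2 ⟨0, Set.mem_image_of_mem f ⟨(hu0 n).le, hu0 n ▸ hu n (Nat.zero_le _)⟩⟩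
    · have hx' : x ∈ Set.Ioc (u n 0) (u n (n + 1)) := by rw [hu0, hun]; exact ⟨hax, hx.2⟩
      rw [← (hu n).biUnion_Ico_Ioc_map_succ] at hx'
      obtain ⟨i, hi, hxi⟩ := Set.mem_iUnion₂.1 hx'
      exact Set.mem_iUnion.2 ⟨⟨i, hi.2⟩, Set.mem_image_of_mem f (Set.Ioc_subset_Icc_self hxi)⟩
  refine (Measure.hausdorffMeasure_le_liminf_sum 1 _ _ hlim t (.of_forall hdiam)
    (.of_forall hcover)).trans ?_
  have hsum (n : ℕ) : ∑ i, Metric.ediam (t n i) ^ (1 : ℝ) ≤ eVariationOn f (Set.Icc a b) := by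
    calc ∑ i, Metric.ediam (t n i) ^ (1 : ℝ)
        ≤ ∑ i : Fin (n + 1), eVariationOn f (Set.Icc (u n i) (u n (i + 1))) := by
          refine Finset.sum_le_sum fun i _ => ?_
          rw [ENNReal.rpow_one]
          exact Metric.ediam_image_le_iff.2 fun x hx y hy => eVariationOn.edist_le f hx hy
      _ = eVariationOn f (Set.Icc a b) := by
          rw [Fin.sum_univ_eq_sum_range fun i => eVariationOn f (Set.Icc (u n i) (u n (i + 1))),
            eVariationOn.sum' f (hu n), hu0, hun]
  exact (Filter.liminf_le_liminf (.of_forall hsum)).trans_eq (Filter.liminf_const _)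

/-- For an injective Lipschitz curve `f : [a,b] → X` with image `A = f([a,b])`,
the one-dimensional Hausdorff measure of the path equals the variation of the
curve: `H¹(A) = Var(f)`. -/
theorem hausdorff_measure_image_eq_variation {X : Type*} [MetricSpace X] [MeasurableSpace X]
    [BorelSpace X] {a b : ℝ} (hab : a ≤ b) {f : ℝ → X} {K : NNReal}
    (hf : LipschitzOnWith K f (Set.Icc a b)) (hinj : Set.InjOn f (Set.Icc a b)) :
    μH[1] (f '' Set.Icc a b) = eVariationOn f (Set.Icc a b) := by
  exact le_antisymm (hf.hausdorffMeasure_image_le_eVariationOn hab)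
    (eVariationOn_le_hausdorffMeasure_image hf.continuousOn hinj)
end

section
/- A complete metric space (X,d) is a path metric space if and only if for any x,y ∈ X and any ε > 0 there is z ∈ X such that max{d(x,z), d(z,y)} ≤ ½·d(x,y) + ε. -/
open Filter Topology Set

/-- The dilatation (metric derivative) of a map `f` at a point `u`, with the
supremum restricted to pairs of points of `s`. -/
noncomputable def dilatationOn {X : Type*} [MetricSpace X] (f : ℝ → X) (s : Set ℝ) (u : ℝ) : ℝ :=
  Filter.limsup
    (fun ε : ℝ => sSup ((fun p : ℝ × ℝ => dist (f p.1) (f p.2) / dist p.1 p.2) ''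
      {p : ℝ × ℝ | p.1 ∈ s ∧ p.2 ∈ s ∧ p.1 ≠ p.2 ∧ dist p.1 u < ε ∧ dist p.2 u < ε}))
    (nhdsWithin 0 (Set.Ioi 0))

/-- The length of a curve `f : [a,b] → X`, `L(f) = ∫_a^b dil(f)(t) dt`. -/
noncomputable def curveLength {X : Type*} [MetricSpace X] (f : ℝ → X) (a b : ℝ) : ℝ :=
  ∫ t in a..b, dilatationOn f (Set.Icc a b) t

/-- A metric space is a path metric space if the distance between any two points
is the infimum of lengths of Lipschitz curves joining them. -/
def IsPathMetricSpace (X : Type*) [MetricSpace X] : Prop :=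
  ∀ x y : X, dist x y = sInf {L : ℝ | ∃ (a b : ℝ) (f : ℝ → X) (K : NNReal), a ≤ b ∧
    LipschitzOnWith K f (Set.Icc a b) ∧ f a = x ∧ f b = y ∧ L = curveLength f a b}

/-- The supremum of the difference quotients of `f` over pairs of points of `s` that are
`ε`-close to `u`. -/
noncomputable def slopeSup {X : Type*} [MetricSpace X] (f : ℝ → X) (s : Set ℝ) (u ε : ℝ) : ℝ :=
  sSup ((fun p : ℝ × ℝ => dist (f p.1) (f p.2) / dist p.1 p.2) ''
    {p : ℝ × ℝ | p.1 ∈ s ∧ p.2 ∈ s ∧ p.1 ≠ p.2 ∧ dist p.1 u < ε ∧ dist p.2 u < ε})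

section Dilatation

variable {X : Type*} [MetricSpace X] {f : ℝ → X} {s : Set ℝ} {K : NNReal}

theorem slopeSup_nonneg (f : ℝ → X) (s : Set ℝ) (u ε : ℝ) : 0 ≤ slopeSup f s u ε := by
  apply Real.sSup_nonneg
  rintro _ ⟨p, -, rfl⟩
  positivity

theorem LipschitzOnWith.div_dist_le (hf : LipschitzOnWith K f s) {v w : ℝ} (hv : v ∈ s)
    (hw : w ∈ s) : dist (f v) (f w) / dist v w ≤ K :=
  div_le_of_le_mul₀ dist_nonneg K.coe_nonneg (hf.dist_le_mul v hv w hw)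

theorem slopeSup_le (hf : LipschitzOnWith K f s) (u ε : ℝ) : slopeSup f s u ε ≤ K := by
  apply Real.sSup_le _ K.coe_nonneg
  rintro _ ⟨p, ⟨h1, h2, -⟩, rfl⟩
  exact hf.div_dist_le h1 h2

theorem div_dist_le_slopeSup (hf : LipschitzOnWith K f s) {u ε v w : ℝ} (hv : v ∈ s)
    (hw : w ∈ s) (hvw : v ≠ w) (hvu : dist v u < ε) (hwu : dist w u < ε) :
    dist (f v) (f w) / dist v w ≤ slopeSup f s u ε := by
  refine le_csSup ⟨K, ?_⟩ ⟨(v, w), ⟨hv, hw, hvw, hvu, hwu⟩, rfl⟩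
  rintro _ ⟨p, ⟨h1, h2, -⟩, rfl⟩
  exact hf.div_dist_le h1 h2

theorem slopeSup_mono (hf : LipschitzOnWith K f s) {u v ε δ : ℝ} (h : δ + dist v u ≤ ε) :
    slopeSup f s v δ ≤ slopeSup f s u ε := by
  apply Real.sSup_le _ (slopeSup_nonneg f s u ε)
  rintro _ ⟨p, ⟨h1, h2, h3, h4, h5⟩, rfl⟩
  exact div_dist_le_slopeSup hf h1 h2 h3 (by linarith [dist_triangle p.1 v u])
    (by linarith [dist_triangle p.2 v u])

theorem isBoundedUnder_le_slopeSup (hf : LipschitzOnWith K f s) (u : ℝ) :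
    (𝓝[>] (0 : ℝ)).IsBoundedUnder (· ≤ ·) (slopeSup f s u) :=
  isBoundedUnder_of ⟨K, slopeSup_le hf u⟩

theorem isCoboundedUnder_le_slopeSup (f : ℝ → X) (s : Set ℝ) (u : ℝ) :
    (𝓝[>] (0 : ℝ)).IsCoboundedUnder (· ≤ ·) (slopeSup f s u) :=
  IsBoundedUnder.isCoboundedUnder_le (isBoundedUnder_of ⟨0, slopeSup_nonneg f s u⟩)

theorem dilatationOn_le_slopeSup (hf : LipschitzOnWith K f s) (u : ℝ) {ε : ℝ} (hε : 0 < ε) :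
    dilatationOn f s u ≤ slopeSup f s u ε := by
  refine limsup_le_of_le (isCoboundedUnder_le_slopeSup f s u) ?_
  filter_upwards [Ioo_mem_nhdsGT hε] with δ hδ
  exact slopeSup_mono hf (by simpa using hδ.2.le)

theorem le_dilatationOn (hf : LipschitzOnWith K f s) {u c : ℝ}
    (h : ∀ ε > 0, c ≤ slopeSup f s u ε) : c ≤ dilatationOn f s u := by
  refine le_limsup_of_le (isBoundedUnder_le_slopeSup hf u) fun b hb => ?_
  obtain ⟨ε, hεb, hε⟩ := (hb.and self_mem_nhdsWithin).exists
  exact (h ε hε).trans hεb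

theorem dilatationOn_nonneg (hf : LipschitzOnWith K f s) (u : ℝ) : 0 ≤ dilatationOn f s u :=
  le_dilatationOn hf fun ε _ => slopeSup_nonneg f s u ε

theorem dilatationOn_le (hf : LipschitzOnWith K f s) (u : ℝ) : dilatationOn f s u ≤ K :=
  (dilatationOn_le_slopeSup hf u one_pos).trans (slopeSup_le hf u 1)

theorem upperSemicontinuous_dilatationOn (hf : LipschitzOnWith K f s) :
    UpperSemicontinuous (dilatationOn f s) := by
  intro u c hc
  obtain ⟨ε, hεc, hε⟩ :=
    ((eventually_lt_of_limsup_lt hc (isBoundedUnder_le_slopeSup hf u)).and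
      self_mem_nhdsWithin).exists
  have hε : 0 < ε := hε
  filter_upwards [Metric.ball_mem_nhds u (half_pos hε)] with v hv
  rw [Metric.mem_ball] at hv
  exact ((dilatationOn_le_slopeSup hf v (half_pos hε)).trans
    (slopeSup_mono hf (by linarith))).trans_lt hεc

theorem intervalIntegrable_dilatationOn (hf : LipschitzOnWith K f s) (a b : ℝ) :
    IntervalIntegrable (dilatationOn f s) MeasureTheory.volume a b := by
  refine (intervalIntegrable_const (c := (K : ℝ))).mono_fun
    (upperSemicontinuous_dilatationOn hf).measurable.aestronglyMeasurable
    (Eventually.of_forall fun u => ?_)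
  simpa [abs_of_nonneg (dilatationOn_nonneg hf u)] using dilatationOn_le hf u

/-- The distance to a fixed point grows along a curve at most at the rate of the dilatation. -/
theorem deriv_dist_le_dilatationOn (hf : LipschitzOnWith K f s) (x : X) {u : ℝ} (hu : s ∈ 𝓝 u) :
    deriv (fun t => dist x (f t)) u ≤ dilatationOn f s u := by
  by_cases hd : DifferentiableAt ℝ (fun t => dist x (f t)) u
  · refine le_dilatationOn hf fun ε hε => ?_
    refine le_of_tendsto hd.hasDerivAt.tendsto_slope ?_
    filter_upwards [self_mem_nhdsWithin, mem_nhdsWithin_of_mem_nhds hu,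
      mem_nhdsWithin_of_mem_nhds (Metric.ball_mem_nhds u hε)] with v hvu hv hvε
    refine le_trans ?_
      (div_dist_le_slopeSup hf hv (mem_of_mem_nhds hu) hvu hvε (by simpa using hε))
    rw [slope_def_field]
    refine (le_abs_self _).trans ?_
    rw [abs_div, Real.dist_eq]
    gcongr
    exact dist_dist_dist_le_right x (f v) (f u)
  · rw [deriv_zero_of_not_differentiableAt hd]
    exact dilatationOn_nonneg hf u

theorem dist_le_integral_dilatationOn {a b c d : ℝ} (hf : LipschitzOnWith K f (Icc a b))
    (hac : a ≤ c) (hcd : c ≤ d) (hdb : d ≤ b) :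
    dist (f c) (f d) ≤ ∫ t in c..d, dilatationOn f (Icc a b) t := by
  have hg : LipschitzOnWith K (fun t => dist (f c) (f t)) (uIcc c d) := by
    rw [uIcc_of_le hcd]
    simpa [Function.comp_def] using (LipschitzWith.dist_right (f c)).comp_lipschitzOnWith
      (hf.mono (Icc_subset_Icc hac hdb))
  have hac' := hg.absolutelyContinuousOnInterval
  have h := hac'.integral_deriv_eq_sub
  rw [dist_self, sub_zero] at h
  rw [← h]
  refine intervalIntegral.integral_mono_on_of_le_Ioo hcd hac'.intervalIntegrable_deriv
    (intervalIntegrable_dilatationOn hf c d) fun t ht => ?_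
  exact deriv_dist_le_dilatationOn hf _
    (Icc_mem_nhds (hac.trans_lt ht.1) (ht.2.trans_le hdb))

theorem dist_le_curveLength {a b : ℝ} (hab : a ≤ b) (hf : LipschitzOnWith K f (Icc a b)) :
    dist (f a) (f b) ≤ curveLength f a b :=
  dist_le_integral_dilatationOn hf le_rfl hab le_rfl

theorem curveLength_le {a b : ℝ} (hab : a ≤ b) (hf : LipschitzOnWith K f (Icc a b)) :
    curveLength f a b ≤ K * (b - a) := by
  have h := intervalIntegral.integral_mono_on hab
    (intervalIntegrable_dilatationOn hf a b) intervalIntegrable_const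
    fun t _ => dilatationOn_le hf t
  simpa [curveLength, mul_comm] using h

/-- A Lipschitz curve contains a point halfway, in distance from its start, between its ends. -/
theorem exists_midpoint_of_curve {a b : ℝ} (hab : a ≤ b) (hf : LipschitzOnWith K f (Icc a b)) :
    ∃ z, dist (f a) z = 1 / 2 * dist (f a) (f b) ∧
      dist z (f b) ≤ curveLength f a b - 1 / 2 * dist (f a) (f b) := by
  have hcont : ContinuousOn (fun t => dist (f a) (f t)) (Icc a b) :=
    (continuous_const.dist continuous_id).comp_continuousOn hf.continuousOn
  have hmem : 1 / 2 * dist (f a) (f b) ∈ Icc (dist (f a) (f a)) (dist (f a) (f b)) := by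
    rw [dist_self]
    constructor <;> linarith [dist_nonneg (x := f a) (y := f b)]
  obtain ⟨c, ⟨hac, hcb⟩, hc⟩ := intermediate_value_Icc hab hcont hmem
  refine ⟨f c, hc, ?_⟩
  have h1 := dist_le_integral_dilatationOn hf le_rfl hac hcb
  have h2 := dist_le_integral_dilatationOn hf hac hcb le_rfl
  have h3 := intervalIntegral.integral_add_adjacent_intervals
    (intervalIntegrable_dilatationOn hf a c) (intervalIntegrable_dilatationOn hf c b)
  simp only [curveLength] at hc ⊢
  linarith

end Dilatation

section Subdivision

variable {X : Type*}

/-- The chain obtained from `x, y, y, …` after `n` rounds of inserting between consecutive points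
`p`, `q` the point `mid m p q` in round `m`. -/
def subdivision (mid : ℕ → X → X → X) (x y : X) : ℕ → ℕ → X
  | 0, k => if k = 0 then x else y
  | n + 1, k =>
    if k % 2 = 0 then subdivision mid x y n (k / 2)
    else mid n (subdivision mid x y n (k / 2)) (subdivision mid x y n (k / 2 + 1))

variable (mid : ℕ → X → X → X) (x y : X)

theorem subdivision_succ_two_mul (n k : ℕ) :
    subdivision mid x y (n + 1) (2 * k) = subdivision mid x y n k := by
  simp [subdivision]

theorem subdivision_succ_two_mul_add_one (n k : ℕ) :
    subdivision mid x y (n + 1) (2 * k + 1) =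
      mid n (subdivision mid x y n k) (subdivision mid x y n (k + 1)) := by
  have h : (2 * k + 1) / 2 = k := by omega
  simp [subdivision, h]

theorem subdivision_zero_right (n : ℕ) : subdivision mid x y n 0 = x := by
  induction n with
  | zero => simp [subdivision]
  | succ n ih => simpa [ih] using subdivision_succ_two_mul mid x y n 0

theorem subdivision_two_pow (n : ℕ) : subdivision mid x y n (2 ^ n) = y := by
  induction n with
  | zero => simp [subdivision]
  | succ n ih => rw [pow_succ', subdivision_succ_two_mul, ih]

variable [MetricSpace X] {mid x y}

theorem dist_subdivision_succ_le {δ : ℝ}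
    (hmid : ∀ n p q, max (dist p (mid n p q)) (dist (mid n p q) q) ≤
      1 / 2 * dist p q + δ * (1 / 4) ^ (n + 1)) (n k : ℕ) :
    dist (subdivision mid x y n k) (subdivision mid x y n (k + 1)) ≤
      (dist x y + δ * (1 - (1 / 2) ^ n)) * (1 / 2) ^ n := by
  induction n generalizing k with
  | zero =>
    rcases k with _ | k <;> simp [subdivision]
  | succ n ih =>
    have key : ∀ j, 1 / 2 * dist (subdivision mid x y n j) (subdivision mid x y n (j + 1)) +
        δ * (1 / 4) ^ (n + 1) ≤
        (dist x y + δ * (1 - (1 / 2) ^ (n + 1))) * (1 / 2) ^ (n + 1) := by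
      intro j
      have h4 : (1 / 4 : ℝ) ^ (n + 1) = ((1 / 2) ^ (n + 1)) ^ 2 := by
        rw [← pow_mul, mul_comm, pow_mul]; norm_num
      rw [h4]
      have := ih j
      rw [pow_succ (1 / 2 : ℝ) n]
      linear_combination 1 / 2 * this
    obtain ⟨j, rfl | rfl⟩ := Nat.even_or_odd' k
    · rw [subdivision_succ_two_mul, subdivision_succ_two_mul_add_one]
      exact ((le_max_left _ _).trans (hmid n _ _)).trans (key j)
    · rw [show 2 * j + 1 + 1 = 2 * (j + 1) by ring, subdivision_succ_two_mul,
        subdivision_succ_two_mul_add_one]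
      exact ((le_max_right _ _).trans (hmid n _ _)).trans (key j)

/-- In a complete space with approximate midpoints, any two points are joined by a curve on
`[0, 1]` whose Lipschitz constant is arbitrarily close to their distance. -/
theorem exists_lipschitzOnWith_of_approx_midpoints [CompleteSpace X]
    (H : ∀ x y : X, ∀ ε : ℝ, 0 < ε → ∃ z : X,
      max (dist x z) (dist z y) ≤ (1 / 2) * dist x y + ε)
    (x y : X) {δ : ℝ} (hδ : 0 < δ) :
    ∃ f : ℝ → X, LipschitzOnWith (dist x y + δ).toNNReal f (Icc 0 1) ∧ f 0 = x ∧ f 1 = y := by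
  choose mid hmid using fun (n : ℕ) (p q : X) =>
    H p q (δ * (1 / 4) ^ (n + 1)) (by positivity)
  set D := dist x y + δ
  have hD0 : 0 ≤ D := by positivity
  set S := subdivision mid x y
  have hS : ∀ n k, dist (S n k) (S n (k + 1)) ≤ D * (1 / 2) ^ n := fun n k =>
    (dist_subdivision_succ_le hmid n k).trans <| by
      gcongr
      nlinarith [pow_pos (one_half_pos (α := ℝ)) n]
  have hS' : ∀ n j k, j ≤ k → dist (S n j) (S n k) ≤ D * (1 / 2) ^ n * ((k : ℝ) - j) := by
    intro n j k hjk
    refine (dist_le_Ico_sum_of_dist_le (f := S n) (d := fun _ => D * (1 / 2) ^ n) hjk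
      fun _ _ => hS n _).trans ?_
    simp [Nat.cast_sub hjk, mul_comm]
  let F : ℕ → ℝ → X := fun n t => S n ⌊t * 2 ^ n⌋₊
  have hF_succ : ∀ t, 0 ≤ t → ∀ n, dist (F n t) (F (n + 1) t) ≤ D * (1 / 2) ^ n := by
    intro t ht n
    set k := ⌊t * 2 ^ n⌋₊
    have ht' : 0 ≤ t * 2 ^ n := by positivity
    have h1 : (k : ℝ) ≤ t * 2 ^ n := Nat.floor_le ht'
    have h2 : t * 2 ^ n < k + 1 := Nat.lt_floor_add_one _
    have hlow : 2 * k ≤ ⌊t * 2 ^ (n + 1)⌋₊ := by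
      apply Nat.le_floor
      push_cast
      rw [pow_succ]
      linarith
    have hup : ⌊t * 2 ^ (n + 1)⌋₊ < 2 * k + 2 := by
      rw [Nat.floor_lt (by positivity)]
      push_cast
      rw [pow_succ]
      linarith
    have hF : F n t = S (n + 1) (2 * k) := (subdivision_succ_two_mul mid x y n k).symm
    rw [hF]
    change dist (S (n + 1) (2 * k)) (S (n + 1) ⌊t * 2 ^ (n + 1)⌋₊) ≤ _
    obtain h | h : ⌊t * 2 ^ (n + 1)⌋₊ = 2 * k ∨ ⌊t * 2 ^ (n + 1)⌋₊ = 2 * k + 1 := by omega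
    · rw [h, dist_self]
      positivity
    · rw [h]
      refine (hS (n + 1) (2 * k)).trans ?_
      gcongr D * ?_
      exact pow_le_pow_of_le_one (by norm_num) (by norm_num) n.le_succ
  have hlim : ∀ t, ∃ z, 0 ≤ t → Tendsto (fun n => F n t) atTop (𝓝 z) := by
    intro t
    by_cases ht : 0 ≤ t
    · obtain ⟨z, hz⟩ := cauchySeq_tendsto_of_complete
        (cauchySeq_of_le_geometric (1 / 2) D (by norm_num) (hF_succ t ht))
      exact ⟨z, fun _ => hz⟩
    · exact ⟨x, fun h => absurd h ht⟩
  choose f hf using hlim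
  have hlip : ∀ s t, 0 ≤ s → s ≤ t → dist (f s) (f t) ≤ D * (t - s) := by
    intro s t hs hst
    have hpow : Tendsto (fun n : ℕ => D * (t - s + (1 / 2) ^ n)) atTop (𝓝 (D * (t - s + 0))) :=
      (tendsto_const_nhds.add
        (tendsto_pow_atTop_nhds_zero_of_lt_one (by norm_num) (by norm_num))).const_mul D
    rw [add_zero] at hpow
    refine le_of_tendsto_of_tendsto' ((hf s hs).dist (hf t (hs.trans hst))) hpow fun n => ?_
    refine (hS' n _ _ (Nat.floor_mono (by gcongr))).trans ?_
    rw [mul_assoc]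
    gcongr D * ?_
    have h1 : (⌊t * 2 ^ n⌋₊ : ℝ) ≤ t * 2 ^ n :=
      Nat.floor_le (mul_nonneg (hs.trans hst) (by positivity))
    have h2 : s * 2 ^ n < (⌊s * 2 ^ n⌋₊ : ℝ) + 1 := Nat.lt_floor_add_one _
    calc (1 / 2 : ℝ) ^ n * ((⌊t * 2 ^ n⌋₊ : ℝ) - ⌊s * 2 ^ n⌋₊)
        ≤ (1 / 2) ^ n * ((t - s) * 2 ^ n + 1) := by
          gcongr
          linarith
      _ = t - s + (1 / 2) ^ n := by
          have h : (1 / 2 : ℝ) ^ n * 2 ^ n = 1 := by rw [← mul_pow]; norm_num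
          linear_combination (t - s) * h
  refine ⟨f, LipschitzOnWith.of_dist_le_mul fun s hs t ht => ?_, ?_, ?_⟩
  · rw [Real.coe_toNNReal D hD0, Real.dist_eq]
    rcases le_total s t with h | h
    · rw [abs_sub_comm, abs_of_nonneg (sub_nonneg.2 h)]
      exact hlip s t hs.1 h
    · rw [dist_comm, abs_of_nonneg (sub_nonneg.2 h)]
      exact hlip t s ht.1 h
  · refine tendsto_nhds_unique (hf 0 le_rfl) ?_
    simp [F, S, subdivision_zero_right]
  · refine tendsto_nhds_unique (hf 1 zero_le_one) ?_
    have h : ∀ n : ℕ, F n 1 = y := by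
      intro n
      have : ⌊(1 : ℝ) * 2 ^ n⌋₊ = 2 ^ n := by
        rw [one_mul]
        exact_mod_cast Nat.floor_natCast (R := ℝ) (2 ^ n)
      simp only [F, this]
      exact subdivision_two_pow mid x y n
    simp [h]

end Subdivision

/-- A complete metric space is a path metric space if and only if for any two points
`x, y` and any `ε > 0` there is an approximate midpoint `z`:
`max (d x z) (d z y) ≤ ½ d(x,y) + ε`. -/
theorem isPathMetricSpace_iff_approx_midpoints (X : Type*) [MetricSpace X] [CompleteSpace X] :
    IsPathMetricSpace X ↔
      ∀ x y : X, ∀ ε : ℝ, 0 < ε → ∃ z : X,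
        max (dist x z) (dist z y) ≤ (1 / 2) * dist x y + ε := by
  constructor
  · intro h x y ε hε
    rcases eq_or_ne x y with rfl | hxy
    · exact ⟨x, by simpa using hε.le⟩
    have hxy' := h x y
    obtain ⟨L, ⟨a, b, f, K, hab, hf, rfl, rfl, rfl⟩, hL⟩ :=
      exists_lt_of_csInf_lt (nonempty_iff_ne_empty.2 fun he => by
        rw [he, Real.sInf_empty] at hxy'
        exact hxy (dist_eq_zero.1 hxy')) (hxy'.symm.trans_lt (lt_add_of_pos_right _ hε))
    obtain ⟨z, hz1, hz2⟩ := exists_midpoint_of_curve hab hf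
    exact ⟨z, max_le (by linarith) (by linarith)⟩
  · intro H x y
    refine (csInf_eq_of_forall_ge_of_forall_gt_exists_lt ?_ ?_ ?_).symm
    · obtain ⟨f, hf, h0, h1⟩ := exists_lipschitzOnWith_of_approx_midpoints H x y one_pos
      exact ⟨_, 0, 1, f, _, zero_le_one, hf, h0, h1, rfl⟩
    · rintro _ ⟨a, b, f, K, hab, hf, rfl, rfl, rfl⟩
      exact dist_le_curveLength hab hf
    · intro w hw
      obtain ⟨f, hf, h0, h1⟩ :=
        exists_lipschitzOnWith_of_approx_midpoints H x y (half_pos (sub_pos.2 hw))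
      refine ⟨_, ⟨0, 1, f, _, zero_le_one, hf, h0, h1, rfl⟩, ?_⟩
      have h := curveLength_le zero_le_one hf
      rw [Real.coe_toNNReal _ (by linarith [dist_nonneg (x := x) (y := y)])] at h
      linarith
end

section
/- Let 𝔤 be a finite-dimensional real Lie algebra with a direct sum decomposition 𝔤 = V₁ ⊕ ... ⊕ V_m into nonzero subspaces, and let δ: (0,∞) → Aut(𝔤) be a family of Lie algebra automorphisms with δ_ε ∘ δ_μ = δ_{εμ} and δ₁ = id, such that each δ_ε acts on V_i as multiplication by a scalar f_i(ε) with f_i: (0,∞) → ℝ continuous and the functions f₁,...,f_m pairwise distinct. Then: (1) there exist real numbers α₁,...,α_m with f_i(ε) = ε^{α_i} for all ε > 0; (2) for any i,j, either [V_i, V_j] = 0 or there exists k with α_k = α_i + α_j and [V_i, V_j] ⊆ V_k. -/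
/-- A continuous multiplicative function on `(0, ∞)` that is nonzero there is a power function. -/
theorem exists_eq_rpow_of_continuousOn_of_mul {f : ℝ → ℝ} (hcont : ContinuousOn f (Set.Ioi 0))
    (hmul : ∀ ε μ : ℝ, 0 < ε → 0 < μ → f (ε * μ) = f ε * f μ)
    (hne : ∀ ε : ℝ, 0 < ε → f ε ≠ 0) :
    ∃ α : ℝ, ∀ ε : ℝ, 0 < ε → f ε = ε ^ α := by
  have hpos : ∀ ε : ℝ, 0 < ε → 0 < f ε := by
    intro ε hε
    have hs := Real.sqrt_pos.mpr hε
    rw [← Real.mul_self_sqrt hε.le, hmul _ _ hs hs]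
    exact mul_self_pos.mpr (hne _ hs)
  let g : ℝ →+ ℝ := AddMonoidHom.mk' (fun t => Real.log (f (Real.exp t))) fun s t => by
    rw [Real.exp_add, hmul _ _ (Real.exp_pos s) (Real.exp_pos t),
      Real.log_mul (hne _ (Real.exp_pos s)) (hne _ (Real.exp_pos t))]
  have hg : Continuous g :=
    (hcont.comp_continuous Real.continuous_exp Real.exp_pos).log
      fun t => hne _ (Real.exp_pos t)
  refine ⟨g 1, fun ε hε => ?_⟩
  have hlin : g (Real.log ε) = Real.log ε * g 1 := by
    have := map_real_smul g hg (Real.log ε) 1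
    simpa using this
  have hlog : g (Real.log ε) = Real.log (f ε) := by
    change Real.log (f (Real.exp (Real.log ε))) = _
    rw [Real.exp_log hε]
  rw [Real.rpow_def_of_pos hε, ← hlin, hlog, Real.exp_log (hpos ε hε)]

/-- Let `T` act on each summand `V k` of a direct sum decomposition as the scalar `a k`. An
eigenvector `z` of `T` has zero component in every summand on which `T` acts by a scalar different
from its eigenvalue. -/
theorem decompose_eq_zero_of_apply_eq_smul {ι K M : Type*} [DecidableEq ι] [Field K]
    [AddCommGroup M] [Module K M] (V : ι → Submodule K M) [DirectSum.Decomposition V]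
    (T : M →ₗ[K] M) (a : ι → K) (hT : ∀ k, ∀ x ∈ V k, T x = a k • x)
    {c : K} {z : M} (hz : T z = c • z) {k : ι} (hk : a k ≠ c) :
    (DirectSum.decompose V z k : M) = 0 := by
  have key : ∀ w : M,
      (DirectSum.decompose V (T w) k : M) = a k • (DirectSum.decompose V w k : M) := by
    intro w
    induction w using DirectSum.Decomposition.inductionOn V with
    | zero => simp
    | @homogeneous i x =>
      rw [hT i x x.2, DirectSum.decompose_smul, DirectSum.smul_apply, Submodule.coe_smul]
      by_cases h : i = k
      · subst h; rfl
      · rw [DirectSum.decompose_of_mem_ne V x.2 h, smul_zero, smul_zero]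
    | add x y hx hy => simp [DirectSum.decompose_add, hx, hy]
  have h := key z
  rw [hz, DirectSum.decompose_smul, DirectSum.smul_apply, Submodule.coe_smul] at h
  have h0 : (a k - c) • (DirectSum.decompose V z k : M) = 0 := by
    rw [sub_smul, h, sub_self]
  exact (smul_eq_zero.mp h0).resolve_left (sub_ne_zero.mpr hk)


/-- A finite-dimensional real Lie algebra with a direct sum decomposition into
nonzero subspaces `V i`, admitting a one-parameter group `δ` of Lie algebra
automorphisms acting on each `V i` as multiplication by the scalar `f i ε`
(the functions `f i` being continuous on `(0,∞)` and pairwise distinct there),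
is graded as the Lie algebra of a Carnot group: the scalars are powers
`f i ε = ε ^ (α i)` and brackets of the pieces land in the piece of
complementary weight (or vanish). -/
theorem carnot_structure_of_dilatations
    {L : Type*} [LieRing L] [LieAlgebra ℝ L] [FiniteDimensional ℝ L]
    {m : ℕ} (V : Fin m → Submodule ℝ L) (hV : DirectSum.IsInternal V)
    (hVne : ∀ i, V i ≠ ⊥)
    (δ : ℝ → L →ₗ⁅ℝ⁆ L) (f : Fin m → ℝ → ℝ)
    (hbij : ∀ ε : ℝ, 0 < ε → Function.Bijective (δ ε))
    (hgrp : ∀ ε μ : ℝ, 0 < ε → 0 < μ → ∀ x : L, δ ε (δ μ x) = δ (ε * μ) x)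
    (hone : ∀ x : L, δ 1 x = x)
    (hscal : ∀ i, ∀ ε : ℝ, 0 < ε → ∀ x ∈ V i, δ ε x = f i ε • x)
    (hcont : ∀ i, ContinuousOn (f i) (Set.Ioi 0))
    (hdist : ∀ i j, i ≠ j → ∃ ε : ℝ, 0 < ε ∧ f i ε ≠ f j ε) :
    ∃ α : Fin m → ℝ,
      (∀ i, ∀ ε : ℝ, 0 < ε → f i ε = ε ^ α i) ∧
      (∀ i j, (∀ x ∈ V i, ∀ y ∈ V j, ⁅x, y⁆ = 0) ∨
        ∃ k, α k = α i + α j ∧ ∀ x ∈ V i, ∀ y ∈ V j, ⁅x, y⁆ ∈ V k) := by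
  classical
  have hpow : ∀ i, ∃ α : ℝ, ∀ ε : ℝ, 0 < ε → f i ε = ε ^ α := by
    intro i
    obtain ⟨x, hx, hx0⟩ := (V i).exists_mem_ne_zero_of_ne_bot (hVne i)
    refine exists_eq_rpow_of_continuousOn_of_mul (hcont i) ?_ ?_
    · intro ε μ hε hμ
      have h := hgrp ε μ hε hμ x
      rw [hscal i μ hμ x hx, map_smul, hscal i ε hε x hx, hscal i _ (mul_pos hε hμ) x hx,
        smul_smul] at h
      rw [← smul_left_injective ℝ hx0 h, mul_comm]
    · intro ε hε h0
      apply hx0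
      apply (hbij ε hε).injective
      rw [hscal i ε hε x hx, h0, zero_smul, map_zero]
  choose α hα using hpow
  have hinj : Function.Injective α := by
    intro i j hij
    by_contra hne
    obtain ⟨ε, hε, h⟩ := hdist i j hne
    exact h (by rw [hα i ε hε, hα j ε hε, hij])
  refine ⟨α, hα, fun i j => ?_⟩
  let _ := hV.chooseDecomposition
  have hcomp : ∀ x ∈ V i, ∀ y ∈ V j, ∀ k, α k ≠ α i + α j →
      (DirectSum.decompose V ⁅x, y⁆ k : L) = 0 := by
    intro x hx y hy k hk
    have h2 : (0 : ℝ) < 2 := two_pos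
    refine decompose_eq_zero_of_apply_eq_smul V (δ 2 : L →ₗ[ℝ] L) (fun k => (2 : ℝ) ^ α k)
      (fun l w hw => ?_) (c := (2 : ℝ) ^ (α i + α j)) ?_ ?_
    · rw [← hα l 2 h2]
      exact hscal l 2 h2 w hw
    · change δ 2 ⁅x, y⁆ = _
      rw [LieHom.map_lie, hscal i 2 h2 x hx, hscal j 2 h2 y hy, smul_lie, lie_smul, smul_smul,
        hα i 2 h2, hα j 2 h2, Real.rpow_add h2]
    · intro h
      exact hk ((Real.rpow_right_inj h2 (by norm_num)).mp h)
  by_cases hex : ∃ k, α k = α i + α j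
  · obtain ⟨k, hk⟩ := hex
    refine Or.inr ⟨k, hk, fun x hx y hy => ?_⟩
    rw [← DirectSum.sum_support_decompose V ⁅x, y⁆]
    refine Submodule.sum_mem _ fun l _ => ?_
    by_cases hl : l = k
    · rw [← hl]
      exact SetLike.coe_mem _
    · rw [hcomp x hx y hy l fun h => hl (hinj (h.trans hk.symm))]
      exact zero_mem _
  · push Not at hex
    refine Or.inl fun x hx y hy => ?_
    rw [← DirectSum.sum_support_decompose V ⁅x, y⁆]
    exact Finset.sum_eq_zero fun l _ => hcomp x hx y hy l (hex l)
end

section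
/- Let 𝔤 be a finite-dimensional real Lie algebra with a direct sum decomposition 𝔤 = W₁ ⊕ ... ⊕ W_m, set V^i = W₁ ⊕ ... ⊕ W_i (with V^0 = 0 and V^k = 𝔤 for k ≥ m), and assume [V^i, V^j] ⊆ V^{i+j} for all i,j. For ε > 0 define δ_ε(Σ x_i) = Σ ε^i x_i (where x_i ∈ W_i). Then for all x,y ∈ 𝔤 the limit [x,y]_n = lim_{ε→0} δ_ε^{-1}[δ_ε x, δ_ε y] exists; explicitly, writing x = Σ_j x_j and y = Σ_k y_k, one has [x,y]_n = Σ_s Σ_{j+k=s} ([x_j, y_k])_s, where (·)_s denotes the W_s-component. Moreover [·,·]_n is a Lie bracket on 𝔤, the Lie algebra (𝔤, [·,·]_n) is nilpotent, and every δ_ε is a Lie algebra automorphism of (𝔤, [·,·]_n). -/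
open Filter Topology

noncomputable section

/-- The dilatation `δ_ε` associated to a system of projections `π i` onto the
pieces `W i` of a direct sum decomposition: `δ_ε x = Σ ε^i • (π i x)`. -/
def dilMap {L : Type*} [AddCommGroup L] [Module ℝ L] (π : ℕ → L →ₗ[ℝ] L) (m : ℕ)
    (ε : ℝ) (x : L) : L :=
  ∑ i ∈ Finset.range (m + 1), ε ^ i • π i x

/-- The nilpotentised bracket `[x,y]_n = Σ_s Σ_{j+k=s} ([x_j, y_k])_s`, where
`(·)_s` is the `W_s`-component and `x_j = π j x`. -/
def nilBracket {L : Type*} [AddCommGroup L] [Module ℝ L] (B : L →ₗ[ℝ] L →ₗ[ℝ] L)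
    (π : ℕ → L →ₗ[ℝ] L) (m : ℕ) (x y : L) : L :=
  ∑ j ∈ Finset.range (m + 1), ∑ k ∈ Finset.range (m + 1), π (j + k) (B (π j x) (π k y))

/-- Iterated bracket `[x₁,[x₂,...,[x_k, z]...]]` of a binary operation. -/
def iterBracket {L : Type*} (br : L → L → L) : List L → L → L
  | [], z => z
  | x :: xs, z => br x (iterBracket br xs z)

section

variable {L : Type*} [AddCommGroup L] [Module ℝ L] {π : ℕ → L →ₗ[ℝ] L} {m : ℕ}

/-- The projections attached to a direct sum decomposition are idempotent. -/
lemma proj_idem (hπhigh : ∀ i : ℕ, m < i → π i = 0)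
    (hπsum : ∀ x : L, ∑ i ∈ Finset.range (m + 1), π i x = x)
    (hπorth : ∀ i j : ℕ, i ≠ j → ∀ x : L, π i (π j x) = 0) (i : ℕ) (x : L) :
    π i (π i x) = π i x := by
  by_cases hi : m < i
  · simp [hπhigh i hi]
  · conv_rhs => rw [← hπsum x, map_sum]
    rw [Finset.sum_eq_single_of_mem i (by simp; omega)]
    exact fun j _ hj => hπorth i j hj.symm x

lemma proj_dilMap (hπhigh : ∀ i : ℕ, m < i → π i = 0)
    (hπsum : ∀ x : L, ∑ i ∈ Finset.range (m + 1), π i x = x)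
    (hπorth : ∀ i j : ℕ, i ≠ j → ∀ x : L, π i (π j x) = 0) (ε : ℝ) (i : ℕ) (x : L) :
    π i (dilMap π m ε x) = ε ^ i • π i x := by
  by_cases hi : m < i
  · simp [hπhigh i hi]
  · rw [dilMap, map_sum, Finset.sum_eq_single_of_mem i (by simp; omega)]
    · rw [map_smul, proj_idem hπhigh hπsum hπorth]
    · intro j _ hj
      rw [map_smul, hπorth i j hj.symm, smul_zero]

lemma dilMap_dilMap_of_mul_eq_one (hπhigh : ∀ i : ℕ, m < i → π i = 0)
    (hπsum : ∀ x : L, ∑ i ∈ Finset.range (m + 1), π i x = x)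
    (hπorth : ∀ i j : ℕ, i ≠ j → ∀ x : L, π i (π j x) = 0) {ε η : ℝ} (h : ε * η = 1) (x : L) :
    dilMap π m ε (dilMap π m η x) = x := by
  conv_lhs => rw [dilMap]
  simp_rw [proj_dilMap hπhigh hπsum hπorth, smul_smul, ← mul_pow, h, one_pow, one_smul]
  exact hπsum x

lemma dilMap_bijective (hπhigh : ∀ i : ℕ, m < i → π i = 0)
    (hπsum : ∀ x : L, ∑ i ∈ Finset.range (m + 1), π i x = x)
    (hπorth : ∀ i j : ℕ, i ≠ j → ∀ x : L, π i (π j x) = 0) {ε : ℝ} (hε : ε ≠ 0) :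
    Function.Bijective (dilMap π m ε) :=
  Function.bijective_iff_has_inverse.2 ⟨dilMap π m ε⁻¹,
    dilMap_dilMap_of_mul_eq_one hπhigh hπsum hπorth (inv_mul_cancel₀ hε),
    dilMap_dilMap_of_mul_eq_one hπhigh hπsum hπorth (mul_inv_cancel₀ hε)⟩

lemma dilMap_sum (π : ℕ → L →ₗ[ℝ] L) (m : ℕ) {ι : Type*} (s : Finset ι) (ε : ℝ) (f : ι → L) :
    dilMap π m ε (∑ a ∈ s, f a) = ∑ a ∈ s, dilMap π m ε (f a) := by
  simp only [dilMap, map_sum, Finset.smul_sum]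
  exact Finset.sum_comm

lemma dilMap_smul (π : ℕ → L →ₗ[ℝ] L) (m : ℕ) (ε c : ℝ) (x : L) :
    dilMap π m ε (c • x) = c • dilMap π m ε x := by
  simp only [dilMap, map_smul, Finset.smul_sum]
  exact Finset.sum_congr rfl fun i _ => smul_comm _ _ _

lemma dilMap_proj (hπhigh : ∀ i : ℕ, m < i → π i = 0)
    (hπsum : ∀ x : L, ∑ i ∈ Finset.range (m + 1), π i x = x)
    (hπorth : ∀ i j : ℕ, i ≠ j → ∀ x : L, π i (π j x) = 0) (ε : ℝ) (i : ℕ) (x : L) :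
    dilMap π m ε (π i x) = ε ^ i • π i x := by
  by_cases hi : m < i
  · simp [hπhigh i hi, dilMap]
  · rw [dilMap, Finset.sum_eq_single_of_mem i (by simp; omega)]
    · rw [proj_idem hπhigh hπsum hπorth]
    · intro j _ hj
      rw [hπorth j i hj, smul_zero]

variable {B : L →ₗ[ℝ] L →ₗ[ℝ] L}

lemma dilMap_nilBracket (hπhigh : ∀ i : ℕ, m < i → π i = 0)
    (hπsum : ∀ x : L, ∑ i ∈ Finset.range (m + 1), π i x = x)
    (hπorth : ∀ i j : ℕ, i ≠ j → ∀ x : L, π i (π j x) = 0) (ε : ℝ) (x y : L) :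
    dilMap π m ε (nilBracket B π m x y)
      = nilBracket B π m (dilMap π m ε x) (dilMap π m ε y) := by
  simp only [nilBracket, dilMap_sum, dilMap_proj hπhigh hπsum hπorth,
    proj_dilMap hπhigh hπsum hπorth, map_smul, LinearMap.smul_apply, smul_smul, pow_add]
  exact Finset.sum_congr rfl fun j _ => Finset.sum_congr rfl fun k _ => by rw [mul_comm]

lemma nilBracket_smul_add_left (a : ℝ) (x x' y : L) :
    nilBracket B π m (a • x + x') y = a • nilBracket B π m x y + nilBracket B π m x' y := by
  simp only [nilBracket, map_add, map_smul, LinearMap.add_apply, LinearMap.smul_apply,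
    Finset.sum_add_distrib, Finset.smul_sum]

lemma nilBracket_smul_add_right (a : ℝ) (x y y' : L) :
    nilBracket B π m x (a • y + y') = a • nilBracket B π m x y + nilBracket B π m x y' := by
  simp only [nilBracket, map_add, map_smul, Finset.sum_add_distrib, Finset.smul_sum]

lemma nilBracket_antisymm (hanti : ∀ x y : L, B x y = -B y x) (x y : L) :
    nilBracket B π m x y = -nilBracket B π m y x := by
  simp only [nilBracket]
  rw [Finset.sum_comm, ← Finset.sum_neg_distrib]
  refine Finset.sum_congr rfl fun j _ => ?_
  rw [← Finset.sum_neg_distrib]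
  refine Finset.sum_congr rfl fun k _ => ?_
  rw [hanti, map_neg, add_comm]

lemma nilBracket_sum_left {ι : Type*} (s : Finset ι) (f : ι → L) (y : L) :
    nilBracket B π m (∑ a ∈ s, f a) y = ∑ a ∈ s, nilBracket B π m (f a) y :=
  map_sum (AddMonoidHom.mk' (fun x => nilBracket B π m x y) fun x x' => by
    simpa using nilBracket_smul_add_left (B := B) (π := π) (m := m) 1 x x' y) f s

lemma nilBracket_sum_right {ι : Type*} (s : Finset ι) (f : ι → L) (x : L) :
    nilBracket B π m x (∑ a ∈ s, f a) = ∑ a ∈ s, nilBracket B π m x (f a) :=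
  map_sum (AddMonoidHom.mk' (fun y => nilBracket B π m x y) fun y y' => by
    simpa using nilBracket_smul_add_right (B := B) (π := π) (m := m) 1 x y y') f s

/-- On homogeneous elements the nilpotentised bracket is the top component of the bracket. -/
lemma nilBracket_proj_proj (hπhigh : ∀ i : ℕ, m < i → π i = 0)
    (hπsum : ∀ x : L, ∑ i ∈ Finset.range (m + 1), π i x = x)
    (hπorth : ∀ i j : ℕ, i ≠ j → ∀ x : L, π i (π j x) = 0) (a b : ℕ) (x y : L) :
    nilBracket B π m (π a x) (π b y) = π (a + b) (B (π a x) (π b y)) := by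
  by_cases ha : m < a
  · simp [hπhigh a ha, nilBracket]
  by_cases hb : m < b
  · simp [hπhigh b hb, nilBracket]
  rw [nilBracket, Finset.sum_eq_single_of_mem a (by simp; omega),
    Finset.sum_eq_single_of_mem b (by simp; omega)]
  · simp only [proj_idem hπhigh hπsum hπorth]
  · intro k _ hk
    simp [hπorth k b hk]
  · intro j _ hj
    simp [hπorth j a hj]

/-- Only the component of degree at least `b` of an element of filtration degree `b` contributes
to the component of degree `a + b` of its bracket with an element of degree `a`. -/
lemma proj_bracket_proj_right (hπhigh : ∀ i : ℕ, m < i → π i = 0)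
    (hπsum : ∀ x : L, ∑ i ∈ Finset.range (m + 1), π i x = x)
    (hfil : ∀ i j s : ℕ, i + j < s → ∀ x y : L, π s (B (π i x) (π j y)) = 0)
    (a b : ℕ) (x w : L) (hw : ∀ s, b < s → π s w = 0) :
    π (a + b) (B (π a x) (π b w)) = π (a + b) (B (π a x) w) := by
  by_cases hb : m < b
  · rw [hπhigh (a + b) (by omega)]; simp
  · conv_rhs => rw [← hπsum w, map_sum, map_sum]
    rw [Finset.sum_eq_single_of_mem b (by simp; omega)]
    intro s _ hs
    rcases lt_or_gt_of_ne hs with h | h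
    · exact hfil a s (a + b) (by omega) x w
    · simp [hw s h]

lemma nilBracket_proj_nilBracket_proj_proj (hπhigh : ∀ i : ℕ, m < i → π i = 0)
    (hπsum : ∀ x : L, ∑ i ∈ Finset.range (m + 1), π i x = x)
    (hπorth : ∀ i j : ℕ, i ≠ j → ∀ x : L, π i (π j x) = 0)
    (hfil : ∀ i j s : ℕ, i + j < s → ∀ x y : L, π s (B (π i x) (π j y)) = 0)
    (a b c : ℕ) (x y z : L) :
    nilBracket B π m (π a x) (nilBracket B π m (π b y) (π c z))
      = π (a + b + c) (B (π a x) (B (π b y) (π c z))) := by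
  rw [nilBracket_proj_proj hπhigh hπsum hπorth b c, nilBracket_proj_proj hπhigh hπsum hπorth,
    proj_bracket_proj_right hπhigh hπsum hfil _ _ _ _ fun s hs => hfil b c s hs y z, add_assoc]

lemma nilBracket_jacobi (hanti : ∀ x y : L, B x y = -B y x)
    (hjac : ∀ x y z : L, B x (B y z) = B (B x y) z + B y (B x z))
    (hπhigh : ∀ i : ℕ, m < i → π i = 0)
    (hπsum : ∀ x : L, ∑ i ∈ Finset.range (m + 1), π i x = x)
    (hπorth : ∀ i j : ℕ, i ≠ j → ∀ x : L, π i (π j x) = 0)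
    (hfil : ∀ i j s : ℕ, i + j < s → ∀ x y : L, π s (B (π i x) (π j y)) = 0) (x y z : L) :
    nilBracket B π m x (nilBracket B π m y z)
      = nilBracket B π m (nilBracket B π m x y) z
        + nilBracket B π m y (nilBracket B π m x z) := by
  have homogeneous (a b c : ℕ) :
      nilBracket B π m (π a x) (nilBracket B π m (π b y) (π c z))
        = nilBracket B π m (nilBracket B π m (π a x) (π b y)) (π c z)
          + nilBracket B π m (π b y) (nilBracket B π m (π a x) (π c z)) := by
    rw [nilBracket_antisymm hanti (nilBracket B π m (π a x) (π b y)),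
      nilBracket_proj_nilBracket_proj_proj hπhigh hπsum hπorth hfil,
      nilBracket_proj_nilBracket_proj_proj hπhigh hπsum hπorth hfil,
      nilBracket_proj_nilBracket_proj_proj hπhigh hπsum hπorth hfil, hjac, map_add,
      hanti (B (π a x) (π b y)), map_neg, show c + a + b = a + b + c by ring,
      show b + a + c = a + b + c by ring]
  have expand_left (u v w : L) : nilBracket B π m u (nilBracket B π m v w)
      = ∑ a ∈ Finset.range (m + 1), ∑ b ∈ Finset.range (m + 1), ∑ c ∈ Finset.range (m + 1),
        nilBracket B π m (π a u) (nilBracket B π m (π b v) (π c w)) := by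
    simp only [← nilBracket_sum_right, ← nilBracket_sum_left, hπsum]
  have expand_right : nilBracket B π m (nilBracket B π m x y) z
      = ∑ a ∈ Finset.range (m + 1), ∑ b ∈ Finset.range (m + 1), ∑ c ∈ Finset.range (m + 1),
        nilBracket B π m (nilBracket B π m (π a x) (π b y)) (π c z) := by
    simp only [← nilBracket_sum_right, ← nilBracket_sum_left, hπsum]
  rw [expand_left x y z, expand_right, expand_left y x z,
    Finset.sum_comm (f := fun b a => ∑ c ∈ Finset.range (m + 1),
      nilBracket B π m (π b y) (nilBracket B π m (π a x) (π c z)))]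
  simp only [homogeneous, Finset.sum_add_distrib]

/-- Bracketing raises the degree by at least the length of the list. -/
lemma proj_iterBracket_nilBracket (hπzero : π 0 = 0)
    (hπorth : ∀ i j : ℕ, i ≠ j → ∀ x : L, π i (π j x) = 0) (l : List L) (z : L) :
    ∀ s ≤ l.length, π s (iterBracket (nilBracket B π m) l z) = 0 := by
  induction l with
  | nil =>
    intro s hs
    obtain rfl : s = 0 := by simpa using hs
    simp [hπzero]
  | cons x l ih =>
    intro s hs
    rw [List.length_cons] at hs
    simp only [iterBracket, nilBracket, map_sum]
    refine Finset.sum_eq_zero fun j _ => Finset.sum_eq_zero fun k _ => ?_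
    by_cases hjk : s = j + k
    · rcases Nat.eq_zero_or_pos j with rfl | hj
      · simp [hπzero]
      · simp [ih k (by omega)]
    · exact hπorth s (j + k) hjk _

end

lemma tendsto_dilMap_bracket {L : Type*} [NormedAddCommGroup L] [NormedSpace ℝ L]
    {B : L →ₗ[ℝ] L →ₗ[ℝ] L} {π : ℕ → L →ₗ[ℝ] L} {m : ℕ} (hπhigh : ∀ i : ℕ, m < i → π i = 0)
    (hfil : ∀ i j s : ℕ, i + j < s → ∀ x y : L, π s (B (π i x) (π j y)) = 0) (x y : L) :
    Tendsto (fun ε : ℝ => dilMap π m ε⁻¹ (B (dilMap π m ε x) (dilMap π m ε y)))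
      (𝓝[>] 0) (𝓝 (nilBracket B π m x y)) := by
  have expand (ε : ℝ) : dilMap π m ε⁻¹ (B (dilMap π m ε x) (dilMap π m ε y))
      = ∑ j ∈ Finset.range (m + 1), ∑ k ∈ Finset.range (m + 1), ∑ i ∈ Finset.range (m + 1),
        (ε ^ j * (ε ^ k * ε⁻¹ ^ i)) • π i (B (π j x) (π k y)) := by
    have hB : B (dilMap π m ε x) (dilMap π m ε y)
        = ∑ j ∈ Finset.range (m + 1), ∑ k ∈ Finset.range (m + 1),
          ε ^ j • ε ^ k • B (π j x) (π k y) := by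
      simp only [dilMap, map_sum, LinearMap.sum_apply, map_smul, LinearMap.smul_apply,
        Finset.smul_sum]
      rw [Finset.sum_comm]
      exact Finset.sum_congr rfl fun j _ => Finset.sum_congr rfl fun k _ => smul_comm _ _ _
    simp only [hB, dilMap_sum, dilMap_smul]
    simp only [dilMap, Finset.smul_sum, smul_smul]
  simp only [expand]
  refine tendsto_finsetSum _ fun j _ => tendsto_finsetSum _ fun k _ => ?_
  have top_component : π (j + k) (B (π j x) (π k y))
      = ∑ i ∈ Finset.range (m + 1), if i = j + k then π i (B (π j x) (π k y)) else 0 := by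
    rw [Finset.sum_ite_eq']
    split_ifs with h
    · rfl
    · rw [hπhigh (j + k) (by simpa using h), LinearMap.zero_apply]
  rw [top_component]
  refine tendsto_finsetSum _ fun i _ => ?_
  rcases lt_trichotomy i (j + k) with h | rfl | h
  · rw [if_neg h.ne]
    have hpow : Tendsto (fun ε : ℝ => ε ^ (j + k - i)) (𝓝[>] 0) (𝓝 0) := by
      have := (continuous_pow (M := ℝ) (j + k - i)).tendsto 0
      rw [zero_pow (by omega)] at this
      exact this.mono_left nhdsWithin_le_nhds
    have := hpow.smul_const (π i (B (π j x) (π k y)))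
    rw [zero_smul] at this
    refine this.congr' ?_
    filter_upwards [self_mem_nhdsWithin] with ε hε
    rw [← mul_assoc, ← pow_add, inv_pow, pow_sub₀ _ (ne_of_gt hε) h.le]
  · rw [if_pos rfl]
    refine tendsto_const_nhds.congr' ?_
    filter_upwards [self_mem_nhdsWithin] with ε hε
    rw [← mul_assoc, ← pow_add, inv_pow, mul_inv_cancel₀ (pow_ne_zero _ (ne_of_gt hε)), one_smul]
  · simp only [hfil j k i h, smul_zero, ite_self]
    exact tendsto_const_nhds

/-- Nilpotentisation of a filtered finite-dimensional real Lie algebra.  The Lie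
algebra is given by its bracket `B`; the decomposition `𝔤 = W₁ ⊕ ... ⊕ W_m` is
encoded by the projections `π i` (with `π 0 = 0`, `π i = 0` for `i > m`,
`Σ π i = id`, `π i ∘ π j = 0` for `i ≠ j`), and the filtration condition
`[V^i, V^j] ⊆ V^{i+j}` says that the `s`-component of `[W_i, W_j]` vanishes for
`s > i + j`.  Then `δ_{ε⁻¹} [δ_ε x, δ_ε y] → [x,y]_n` as `ε → 0⁺`; the limit
`[·,·]_n` is an (explicitly given) Lie bracket, the resulting Lie algebra is
nilpotent, and every `δ_ε` (ε > 0) is an automorphism of it. -/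
theorem nilpotentisation_bracket
    {L : Type*} [NormedAddCommGroup L] [NormedSpace ℝ L] [FiniteDimensional ℝ L]
    (B : L →ₗ[ℝ] L →ₗ[ℝ] L)
    (hanti : ∀ x y : L, B x y = -B y x)
    (hjac : ∀ x y z : L, B x (B y z) = B (B x y) z + B y (B x z))
    (m : ℕ) (hm : 1 ≤ m) (π : ℕ → L →ₗ[ℝ] L)
    (hπzero : π 0 = 0) (hπhigh : ∀ i : ℕ, m < i → π i = 0)
    (hπsum : ∀ x : L, ∑ i ∈ Finset.range (m + 1), π i x = x)
    (hπorth : ∀ i j : ℕ, i ≠ j → ∀ x : L, π i (π j x) = 0)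
    (hfil : ∀ i j s : ℕ, i + j < s → ∀ x y : L, π s (B (π i x) (π j y)) = 0) :
    (∀ x y : L,
      Tendsto (fun ε : ℝ => dilMap π m ε⁻¹ (B (dilMap π m ε x) (dilMap π m ε y)))
        (nhdsWithin 0 (Set.Ioi 0)) (nhds (nilBracket B π m x y))) ∧
    (∀ x y : L, nilBracket B π m x y = -nilBracket B π m y x) ∧
    (∀ (a : ℝ) (x x' y : L),
      nilBracket B π m (a • x + x') y = a • nilBracket B π m x y + nilBracket B π m x' y) ∧
    (∀ (a : ℝ) (x y y' : L),
      nilBracket B π m x (a • y + y') = a • nilBracket B π m x y + nilBracket B π m x y') ∧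
    (∀ x y z : L, nilBracket B π m x (nilBracket B π m y z)
      = nilBracket B π m (nilBracket B π m x y) z
        + nilBracket B π m y (nilBracket B π m x z)) ∧
    (∃ nsteps : ℕ, ∀ l : List L, nsteps ≤ l.length → ∀ z : L,
      iterBracket (nilBracket B π m) l z = 0) ∧
    (∀ ε : ℝ, 0 < ε → Function.Bijective (dilMap π m ε) ∧
      ∀ x y : L, dilMap π m ε (nilBracket B π m x y)
        = nilBracket B π m (dilMap π m ε x) (dilMap π m ε y)) := by
  refine ⟨tendsto_dilMap_bracket hπhigh hfil, nilBracket_antisymm hanti,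
    nilBracket_smul_add_left, nilBracket_smul_add_right,
    nilBracket_jacobi hanti hjac hπhigh hπsum hπorth hfil, ⟨m, fun l hl z => ?_⟩,
    fun ε hε => ⟨dilMap_bijective hπhigh hπsum hπorth hε.ne',
      dilMap_nilBracket hπhigh hπsum hπorth ε⟩⟩
  rw [← hπsum (iterBracket (nilBracket B π m) l z)]
  refine Finset.sum_eq_zero fun s hs => ?_
  rw [Finset.mem_range] at hs
  exact proj_iterBracket_nilBracket hπzero hπorth l z s (by omega)
end
end

section
/- (Ball-Box theorem for the Heisenberg group) Let n ≥ 1 and let d_CC be the Carnot–Carathéodory distance on the Heisenberg group H(n). For r > 0 set Box(r) = { (x,x̄) ∈ ℝ^{2n}×ℝ : ‖x‖ ≤ r and |x̄| ≤ r² }. Then there exist constants c, C > 0 such that for every r > 0: Box(c·r) ⊆ B_CC(0,r) ⊆ Box(C·r), where B_CC(0,r) is the open d_CC-ball of radius r centred at the identity. -/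
open Filter Topology Set MeasureTheory

noncomputable section

/-- The underlying space `ℝ^{2n}` of the horizontal part of the Heisenberg group. -/
abbrev Epl (n : ℕ) := EuclideanSpace ℝ (Fin (2 * n))

def idxA {n : ℕ} (i : Fin n) : Fin (2 * n) := ⟨i, by have := i.isLt; omega⟩
def idxB {n : ℕ} (i : Fin n) : Fin (2 * n) := ⟨n + i, by have := i.isLt; omega⟩

/-- The standard symplectic form on `ℝ^{2n}`:
`ω(x,y) = Σ_i (x_i y_{n+i} - x_{n+i} y_i)`. -/
def omegaForm {n : ℕ} (x y : Epl n) : ℝ :=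
  ∑ i : Fin n, (x (idxA i) * y (idxB i) - x (idxB i) * y (idxA i))

/-- A point of the Heisenberg group `H(n) = ℝ^{2n} × ℝ`. -/
abbrev Hpt (n : ℕ) := Epl n × ℝ

/-- Heisenberg group multiplication `(x,x̄)·(y,ȳ) = (x+y, x̄+ȳ+½ω(x,y))`. -/
def hMul {n : ℕ} (p q : Hpt n) : Hpt n :=
  (p.1 + q.1, p.2 + q.2 + (1 / 2) * omegaForm p.1 q.1)

/-- Heisenberg group inverse. -/
def hInv {n : ℕ} (p : Hpt n) : Hpt n := (-p.1, -p.2)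

/-- Heisenberg dilatation `δ_ε(x,x̄) = (εx, ε²x̄)`. -/
def hDil {n : ℕ} (ε : ℝ) (p : Hpt n) : Hpt n := (ε • p.1, ε ^ 2 * p.2)

/-- `γ'` is an a.e. derivative of the horizontal Lipschitz curve `(γ, γb)` on `[0,1]`:
a.e. `γ` has derivative `γ' t` and `γb` has derivative `½ ω(γ t, γ' t)`. -/
def IsHorizontalLift {n : ℕ} (γ : ℝ → Epl n) (γb : ℝ → ℝ) (γ' : ℝ → Epl n) : Prop :=
  ∀ᵐ t ∂(volume.restrict (Set.Icc (0 : ℝ) 1)),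
    HasDerivAt γ (γ' t) t ∧ HasDerivAt γb ((1 / 2) * omegaForm (γ t) (γ' t)) t

/-- The Carnot–Carathéodory distance on the Heisenberg group `H(n)`:
the infimum of `∫₀¹ ‖γ'(t)‖ dt` over horizontal Lipschitz curves joining the points. -/
def ccDist (n : ℕ) (p q : Hpt n) : ℝ :=
  sInf {L : ℝ | ∃ (γ : ℝ → Epl n) (γb : ℝ → ℝ) (γ' : ℝ → Epl n) (K : NNReal),
    LipschitzOnWith K (fun t => ((γ t, γb t) : Hpt n)) (Set.Icc 0 1) ∧
    (γ 0, γb 0) = p ∧ (γ 1, γb 1) = q ∧ IsHorizontalLift γ γb γ' ∧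
    L = ∫ t in (0 : ℝ)..1, ‖γ' t‖}

lemma abs_omegaForm_le {n : ℕ} (x y : Epl n) : |omegaForm x y| ≤ 2 * n * (‖x‖ * ‖y‖) := by
  have hcoord (z : Epl n) (j : Fin (2 * n)) : |z j| ≤ ‖z‖ := PiLp.norm_apply_le z j
  have hmul (j k : Fin (2 * n)) : |x j * y k| ≤ ‖x‖ * ‖y‖ := by
    rw [abs_mul]
    exact mul_le_mul (hcoord x j) (hcoord y k) (abs_nonneg _) (norm_nonneg _)
  calc |omegaForm x y|
      ≤ ∑ i : Fin n, |x (idxA i) * y (idxB i) - x (idxB i) * y (idxA i)| :=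
        Finset.abs_sum_le_sum_abs _ _
    _ ≤ ∑ _i : Fin n, 2 * (‖x‖ * ‖y‖) := by
        refine Finset.sum_le_sum fun i _ => (abs_sub _ _).trans ?_
        linarith [hmul (idxA i) (idxB i), hmul (idxB i) (idxA i)]
    _ = 2 * n * (‖x‖ * ‖y‖) := by simp; ring

lemma omegaForm_add_left {n : ℕ} (x y z : Epl n) :
    omegaForm (x + y) z = omegaForm x z + omegaForm y z := by
  simp only [omegaForm, PiLp.add_apply, ← Finset.sum_add_distrib]
  exact Finset.sum_congr rfl fun i _ => by ring

lemma omegaForm_smul_left {n : ℕ} (a : ℝ) (x y : Epl n) :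
    omegaForm (a • x) y = a * omegaForm x y := by
  simp only [omegaForm, PiLp.smul_apply, smul_eq_mul, Finset.mul_sum]
  exact Finset.sum_congr rfl fun i _ => by ring

lemma omegaForm_swap {n : ℕ} (x y : Epl n) : omegaForm x y = -omegaForm y x := by
  simp only [omegaForm, ← Finset.sum_neg_distrib]
  exact Finset.sum_congr rfl fun i _ => by ring

lemma omegaForm_self {n : ℕ} (x : Epl n) : omegaForm x x = 0 := by
  linarith [omegaForm_swap x x]

lemma omegaForm_add_right {n : ℕ} (x y z : Epl n) :
    omegaForm x (y + z) = omegaForm x y + omegaForm x z := by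
  rw [omegaForm_swap, omegaForm_add_left, omegaForm_swap y, omegaForm_swap z]
  ring

lemma omegaForm_smul_right {n : ℕ} (a : ℝ) (x y : Epl n) :
    omegaForm x (a • y) = a * omegaForm x y := by
  rw [omegaForm_swap, omegaForm_smul_left, omegaForm_swap y]
  ring

lemma omegaForm_single_idxA_idxB {n : ℕ} (i : Fin n) :
    omegaForm (EuclideanSpace.single (idxA i) (1 : ℝ))
      (EuclideanSpace.single (idxB i) (1 : ℝ)) = 1 := by
  have hA (j : Fin n) : idxA j = idxA i ↔ j = i := by simp [idxA, Fin.ext_iff]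
  have hB (j : Fin n) : idxB j = idxB i ↔ j = i := by simp [idxB, Fin.ext_iff]
  have hBA (j : Fin n) : idxB j ≠ idxA i := by
    have := i.isLt
    simp only [idxA, idxB, ne_eq, Fin.ext_iff]
    omega
  simp [omegaForm, hA, hB, hBA]

/-- The mean value inequality for Lipschitz functions with an a.e. derivative bound. -/
lemma abs_sub_le_integral_of_ae_hasDerivAt {f f' g : ℝ → ℝ} {K : NNReal} {a b : ℝ} (hab : a ≤ b)
    (hf : LipschitzOnWith K f (Icc a b))
    (hf' : ∀ᵐ t ∂(volume.restrict (Icc a b)), HasDerivAt f (f' t) t ∧ |f' t| ≤ g t)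
    (hg : IntervalIntegrable g volume a b) :
    |f b - f a| ≤ ∫ t in a..b, g t := by
  have hac : AbsolutelyContinuousOnInterval f a b :=
    LipschitzOnWith.absolutelyContinuousOnInterval (by rwa [uIcc_of_le hab])
  rw [← hac.integral_deriv_eq_sub, ← Real.norm_eq_abs]
  refine intervalIntegral.norm_integral_le_of_norm_le hab ?_ hg
  have h := ae_restrict_of_ae_restrict_of_subset Ioc_subset_Icc_self hf'
  rw [ae_restrict_iff' measurableSet_Ioc] at h
  filter_upwards [h] with t ht hmem
  obtain ⟨hd, hle⟩ := ht hmem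
  rwa [hd.deriv, Real.norm_eq_abs]

lemma intervalIntegrable_norm_of_ae_hasDerivAt {E : Type*} [NormedAddCommGroup E]
    [NormedSpace ℝ E] [CompleteSpace E] {γ γ' : ℝ → E} {K : NNReal} {a b : ℝ} (hab : a ≤ b)
    (hγ : LipschitzOnWith K γ (Icc a b))
    (hγ' : ∀ᵐ t ∂(volume.restrict (Icc a b)), HasDerivAt γ (γ' t) t) :
    IntervalIntegrable (fun t => ‖γ' t‖) volume a b := by
  rw [intervalIntegrable_iff_integrableOn_Ioo_of_le hab]
  have h := ae_restrict_of_ae_restrict_of_subset Ioo_subset_Icc_self hγ'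
  have hmeas : AEStronglyMeasurable γ' (volume.restrict (Ioo a b)) :=
    (aestronglyMeasurable_deriv γ _).congr (h.mono fun t ht => ht.deriv)
  refine Integrable.of_bound hmeas.norm (K : ℝ) ?_
  filter_upwards [h, ae_restrict_mem measurableSet_Ioo] with t ht hmem
  rw [norm_norm]
  exact ht.le_of_lipschitzOn (Icc_mem_nhds hmem.1 hmem.2) hγ

/-- The length of a Lipschitz curve issuing from the origin bounds its distance from the origin. -/
lemma norm_le_integral_norm_of_ae_hasDerivAt {E : Type*} [NormedAddCommGroup E]
    [InnerProductSpace ℝ E] [CompleteSpace E] {γ γ' : ℝ → E} {K : NNReal}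
    (hγ : LipschitzOnWith K γ (Icc 0 1))
    (hγ' : ∀ᵐ t ∂(volume.restrict (Icc (0 : ℝ) 1)), HasDerivAt γ (γ' t) t)
    (h0 : γ 0 = 0) {t : ℝ} (ht : t ∈ Icc (0 : ℝ) 1) :
    ‖γ t‖ ≤ ∫ s in (0 : ℝ)..1, ‖γ' s‖ := by
  have hint := intervalIntegrable_norm_of_ae_hasDerivAt zero_le_one hγ hγ'
  have hsub : Icc 0 t ⊆ Icc (0 : ℝ) 1 := Icc_subset_Icc_right ht.2
  have hint_t : IntervalIntegrable (fun s => ‖γ' s‖) volume 0 t :=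
    hint.mono_set (by rwa [uIcc_of_le ht.1, uIcc_of_le zero_le_one])
  have hmono : ∫ s in (0 : ℝ)..t, ‖γ' s‖ ≤ ∫ s in (0 : ℝ)..1, ‖γ' s‖ :=
    intervalIntegral.integral_mono_interval le_rfl ht.1 ht.2
      (ae_of_all _ fun _ => norm_nonneg _) hint
  have key := abs_sub_le_integral_of_ae_hasDerivAt (f := fun s => innerSL ℝ (γ t) (γ s))
    (f' := fun s => innerSL ℝ (γ t) (γ' s)) (g := fun s => ‖γ t‖ * ‖γ' s‖) ht.1
    ((innerSL ℝ (γ t)).lipschitz.comp_lipschitzOnWith (hγ.mono hsub))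
    ((ae_restrict_of_ae_restrict_of_subset hsub hγ').mono fun s hs =>
      ⟨(innerSL ℝ (γ t)).hasFDerivAt.comp_hasDerivAt s hs,
        by simpa using abs_real_inner_le_norm (γ t) (γ' s)⟩)
    (hint_t.const_mul _)
  rw [intervalIntegral.integral_const_mul] at key
  simp only [h0, map_zero, sub_zero, innerSL_apply_apply, real_inner_self_eq_norm_mul_norm,
    abs_mul_self] at key
  rcases (norm_nonneg (γ t)).eq_or_lt with hz | hpos
  · rw [← hz]
    exact intervalIntegral.integral_nonneg zero_le_one fun _ _ => norm_nonneg _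
  · exact (le_of_mul_le_mul_left key hpos).trans hmono

/-- Upper bounds for the endpoint of a horizontal curve in terms of its length. -/
lemma IsHorizontalLift.endpoint_bounds {n : ℕ} {γ : ℝ → Epl n} {γb : ℝ → ℝ} {γ' : ℝ → Epl n}
    {K : NNReal} (hlip : LipschitzOnWith K (fun t => ((γ t, γb t) : Hpt n)) (Icc 0 1))
    (h0 : γ 0 = 0) (hb0 : γb 0 = 0) (h : IsHorizontalLift γ γb γ') :
    ‖γ 1‖ ≤ ∫ t in (0 : ℝ)..1, ‖γ' t‖ ∧ |γb 1| ≤ n * (∫ t in (0 : ℝ)..1, ‖γ' t‖) ^ 2 := by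
  set L := ∫ t in (0 : ℝ)..1, ‖γ' t‖
  have hγ : LipschitzOnWith K γ (Icc 0 1) := by
    simpa only [one_mul, Function.comp_def] using LipschitzWith.prod_fst.comp_lipschitzOnWith hlip
  have hγb : LipschitzOnWith K γb (Icc 0 1) := by
    simpa only [one_mul, Function.comp_def] using LipschitzWith.prod_snd.comp_lipschitzOnWith hlip
  have hγ' : ∀ᵐ t ∂(volume.restrict (Icc (0 : ℝ) 1)), HasDerivAt γ (γ' t) t :=
    h.mono fun t ht => ht.1
  have hbound : ∀ t ∈ Icc (0 : ℝ) 1, ‖γ t‖ ≤ L := fun t ht =>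
    norm_le_integral_norm_of_ae_hasDerivAt hγ hγ' h0 ht
  have hint := intervalIntegrable_norm_of_ae_hasDerivAt zero_le_one hγ hγ'
  refine ⟨hbound 1 (right_mem_Icc.2 zero_le_one), ?_⟩
  have key := abs_sub_le_integral_of_ae_hasDerivAt (f := γb)
    (f' := fun t => (1 / 2) * omegaForm (γ t) (γ' t)) (g := fun t => n * L * ‖γ' t‖)
    zero_le_one hγb ?_ (hint.const_mul _)
  · rw [intervalIntegral.integral_const_mul, hb0, sub_zero] at key
    exact key.trans_eq (by ring)
  · filter_upwards [h, ae_restrict_mem measurableSet_Icc] with t ht hmem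
    refine ⟨ht.2, ?_⟩
    have hle : ‖γ t‖ * ‖γ' t‖ ≤ L * ‖γ' t‖ :=
      mul_le_mul_of_nonneg_right (hbound t hmem) (norm_nonneg _)
    have hn : (0 : ℝ) ≤ 2 * n := by positivity
    rw [abs_mul, abs_of_pos (by norm_num : (0 : ℝ) < 1 / 2)]
    linarith [abs_omegaForm_le (γ t) (γ' t), mul_le_mul_of_nonneg_left hle hn]

/-- Every real number is a product of two factors of equal modulus. -/
lemma exists_mul_eq_of_abs_eq_sqrt (z : ℝ) :
    ∃ a b : ℝ, a * b = z ∧ |a| = √|z| ∧ |b| = √|z| := by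
  have h := Real.mul_self_sqrt (abs_nonneg z)
  rcases le_total 0 z with hz | hz
  · exact ⟨√|z|, √|z|, by rw [h, abs_of_nonneg hz], abs_of_nonneg (Real.sqrt_nonneg _),
      abs_of_nonneg (Real.sqrt_nonneg _)⟩
  · exact ⟨√|z|, -√|z|, by rw [mul_neg, h, abs_of_nonpos hz, neg_neg],
      abs_of_nonneg (Real.sqrt_nonneg _), by rw [abs_neg, abs_of_nonneg (Real.sqrt_nonneg _)]⟩

/-- Each point of `H(n)` is joined to the identity by a horizontal curve of length controlled by
the homogeneous norm: the straight segment perturbed by a loop of zero mean enclosing the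
required symplectic area. -/
lemma exists_horizontal_curve {n : ℕ} (hn : 1 ≤ n) (p : Hpt n) :
    ∃ (γ : ℝ → Epl n) (γb : ℝ → ℝ) (γ' : ℝ → Epl n) (K : NNReal),
      LipschitzOnWith K (fun t => ((γ t, γb t) : Hpt n)) (Icc 0 1) ∧
      (γ 0, γb 0) = (0, 0) ∧ (γ 1, γb 1) = p ∧ IsHorizontalLift γ γb γ' ∧
      ∫ t in (0 : ℝ)..1, ‖γ' t‖ ≤ ‖p.1‖ + 14 * √(350 * |p.2|) := by
  obtain ⟨x, z⟩ := p
  obtain ⟨a, b, hab, ha, hb⟩ := exists_mul_eq_of_abs_eq_sqrt (350 * z)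
  rw [abs_mul, abs_of_pos (by norm_num : (0 : ℝ) < 350)] at ha hb
  set e : Epl n := EuclideanSpace.single (idxA ⟨0, hn⟩) (1 : ℝ) with he
  set f : Epl n := EuclideanSpace.single (idxB ⟨0, hn⟩) (1 : ℝ) with hf
  have hef : omegaForm e f = 1 := omegaForm_single_idxA_idxB _
  have hfe : omegaForm f e = -1 := by rw [omegaForm_swap, hef]
  have hne : ‖e‖ = 1 := by simp [he]
  have hnf : ‖f‖ = 1 := by simp [hf]
  let γ : ℝ → Epl n := fun t => t • x + ((a * (t - 3 * t ^ 2 + 2 * t ^ 3)) • e +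
    (b * (-t / 5 + 6 / 5 * t ^ 2 - 2 * t ^ 3 + t ^ 4)) • f)
  let γ' : ℝ → Epl n := fun t => x + ((a * (1 - 6 * t + 6 * t ^ 2)) • e +
    (b * (-1 / 5 + 12 / 5 * t - 6 * t ^ 2 + 4 * t ^ 3)) • f)
  let γb : ℝ → ℝ := fun t => 1 / 2 * (
    a * omegaForm x e * (-t ^ 3 + t ^ 4) +
    b * omegaForm x f * (2 / 5 * t ^ 3 - t ^ 4 + 3 / 5 * t ^ 5) +
    a * b * (t ^ 3 / 5 - 4 / 5 * t ^ 4 + 33 / 25 * t ^ 5 - t ^ 6 + 2 / 7 * t ^ 7))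
  have hpow (k : ℕ) (t : ℝ) : HasDerivAt (fun s : ℝ => s ^ k) (k * t ^ (k - 1)) t :=
    hasDerivAt_pow k t
  have hγ (t : ℝ) : HasDerivAt γ (γ' t) t := by
    have h₁ : HasDerivAt (fun t : ℝ => a * (t - 3 * t ^ 2 + 2 * t ^ 3))
        (a * (1 - 6 * t + 6 * t ^ 2)) t := by
      refine ((((hasDerivAt_id t).sub ((hpow 2 t).const_mul 3)).add
        ((hpow 3 t).const_mul 2)).const_mul a).congr_deriv ?_
      push_cast
      ring
    have h₂ : HasDerivAt (fun t : ℝ => b * (-t / 5 + 6 / 5 * t ^ 2 - 2 * t ^ 3 + t ^ 4))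
        (b * (-1 / 5 + 12 / 5 * t - 6 * t ^ 2 + 4 * t ^ 3)) t := by
      refine (((((((hasDerivAt_id t).neg).div_const 5).add ((hpow 2 t).const_mul (6 / 5))).sub
        ((hpow 3 t).const_mul 2)).add (hpow 4 t)).const_mul b).congr_deriv ?_
      push_cast
      ring
    exact (((hasDerivAt_id t).smul_const x).add
      ((h₁.smul_const e).add (h₂.smul_const f))).congr_deriv (by simp only [one_smul, γ'])
  have hγb (t : ℝ) : HasDerivAt γb ((1 / 2) * omegaForm (γ t) (γ' t)) t := by
    have h := (((((hpow 3 t).neg.add (hpow 4 t)).const_mul (a * omegaForm x e)).add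
      (((((hpow 3 t).const_mul (2 / 5)).sub (hpow 4 t)).add
        ((hpow 5 t).const_mul (3 / 5))).const_mul (b * omegaForm x f))).add
      ((((((hpow 3 t).div_const 5).sub ((hpow 4 t).const_mul (4 / 5))).add
        ((hpow 5 t).const_mul (33 / 25))).sub (hpow 6 t)).add
        ((hpow 7 t).const_mul (2 / 7)) |>.const_mul (a * b))).const_mul (1 / 2)
    refine h.congr_deriv ?_
    simp only [γ, γ', omegaForm_add_left, omegaForm_add_right, omegaForm_smul_left,
      omegaForm_smul_right, omegaForm_self, hef, hfe, omegaForm_swap e x, omegaForm_swap f x]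
    norm_num
    ring
  obtain ⟨K, hK⟩ : ∃ K, LipschitzOnWith K (fun t => ((γ t, γb t) : Hpt n)) (Icc 0 1) := by
    have hsmooth : ContDiff ℝ 1 (fun t => ((γ t, γb t) : Hpt n)) := by
      simp only [γ, γb]
      fun_prop
    exact LocallyLipschitzOn.exists_lipschitzOnWith_of_compact isCompact_Icc
      (hsmooth.contDiffOn.locallyLipschitzOn (convex_Icc 0 1))
  refine ⟨γ, γb, γ', K, hK, ?_, ?_, ae_of_all _ fun t => ⟨hγ t, hγb t⟩, ?_⟩
  · simp [γ, γb]
  · refine Prod.ext ?_ ?_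
    · simp only [γ]
      norm_num
    · simp only [γb]
      rw [hab]
      ring
  have hbound : ∀ t ∈ uIoc (0 : ℝ) 1, ‖‖γ' t‖‖ ≤ ‖x‖ + 14 * √(350 * |z|) := by
    intro t ht
    rw [uIoc_of_le zero_le_one] at ht
    obtain ⟨ht0, ht1⟩ := ht
    have h₁ : |1 - 6 * t + 6 * t ^ 2| ≤ 1 :=
      abs_le.2 ⟨by nlinarith [sq_nonneg (t - 1 / 2)], by nlinarith⟩
    have ht2 : t ^ 2 ≤ 1 := pow_le_one₀ ht0.le ht1
    have ht3 : t ^ 3 ≤ 1 := pow_le_one₀ ht0.le ht1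
    have ht2' : 0 ≤ t ^ 2 := by positivity
    have ht3' : 0 ≤ t ^ 3 := by positivity
    have h₂ : |-1 / 5 + 12 / 5 * t - 6 * t ^ 2 + 4 * t ^ 3| ≤ 13 :=
      abs_le.2 ⟨by linarith, by linarith⟩
    rw [norm_norm]
    refine (norm_add_le _ _).trans <| add_le_add_right ((norm_add_le _ _).trans ?_) _
    rw [norm_smul, norm_smul, hne, hnf, Real.norm_eq_abs, Real.norm_eq_abs, abs_mul, abs_mul,
      ha, hb]
    nlinarith [mul_le_mul_of_nonneg_left h₁ (Real.sqrt_nonneg (350 * |z|)),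
      mul_le_mul_of_nonneg_left h₂ (Real.sqrt_nonneg (350 * |z|))]
  have h := intervalIntegral.norm_integral_le_of_norm_le_const hbound
  rw [sub_zero, abs_one, mul_one] at h
  exact (le_abs_self _).trans h

/-- Ball-Box theorem for the Heisenberg group `H(n)`: there are constants
`c, C > 0` such that for every `r > 0`,
`Box(c·r) ⊆ B_CC(0,r) ⊆ Box(C·r)`, where `Box(ρ) = {(x,x̄) : ‖x‖ ≤ ρ, |x̄| ≤ ρ²}`. -/
theorem heisenberg_ball_box (n : ℕ) (hn : 1 ≤ n) :
    ∃ c C : ℝ, 0 < c ∧ 0 < C ∧ ∀ r : ℝ, 0 < r →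
      ({p : Hpt n | ‖p.1‖ ≤ c * r ∧ |p.2| ≤ (c * r) ^ 2} ⊆
          {p : Hpt n | ccDist n (0, 0) p < r}) ∧
      ({p : Hpt n | ccDist n (0, 0) p < r} ⊆
          {p : Hpt n | ‖p.1‖ ≤ C * r ∧ |p.2| ≤ (C * r) ^ 2}) := by
  have hn' : (1 : ℝ) ≤ n := by exact_mod_cast hn
  refine ⟨1 / 1000, n, by norm_num, by linarith, fun r hr => ⟨?_, ?_⟩⟩
  · rintro p ⟨hx, hz⟩
    obtain ⟨γ, γb, γ', K, hK, h0, h1, hlift, hlen⟩ := exists_horizontal_curve hn p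
    have hle : ccDist n (0, 0) p ≤ ∫ t in (0 : ℝ)..1, ‖γ' t‖ := by
      refine csInf_le ⟨0, ?_⟩ ⟨γ, γb, γ', K, hK, h0, h1, hlift, rfl⟩
      rintro _ ⟨_, _, _, _, _, _, _, _, rfl⟩
      exact intervalIntegral.integral_nonneg zero_le_one fun _ _ => norm_nonneg _
    have hsqrt : √(350 * |p.2|) ≤ 20 * (1 / 1000 * r) :=
      Real.sqrt_le_iff.2 ⟨by positivity, by nlinarith⟩
    change ccDist n (0, 0) p < r
    linarith
  · intro p hp
    obtain ⟨γ₀, γb₀, γ₀', K₀, hK₀, h0₀, h1₀, hlift₀, -⟩ := exists_horizontal_curve hn p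
    change sInf _ < r at hp
    obtain ⟨_, ⟨γ, γb, γ', K, hK, h0, h1, hlift, rfl⟩, hlt⟩ :=
      exists_lt_of_csInf_lt (by exact ⟨_, γ₀, γb₀, γ₀', K₀, hK₀, h0₀, h1₀, hlift₀, rfl⟩) hp
    obtain ⟨hγ, hγb⟩ := hlift.endpoint_bounds hK (congrArg Prod.fst h0) (congrArg Prod.snd h0)
    have hL : 0 ≤ ∫ t in (0 : ℝ)..1, ‖γ' t‖ :=
      intervalIntegral.integral_nonneg zero_le_one fun _ _ => norm_nonneg _
    rw [← h1]
    refine ⟨by nlinarith, hγb.trans ?_⟩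
    rw [mul_pow]
    exact mul_le_mul (by nlinarith) (pow_le_pow_left₀ hL hlt.le 2) (sq_nonneg _) (sq_nonneg _)
end
end
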